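/- The smallest Euclidean space into which $K_n$ can be topologically embedded is $\mathbb{R}^{n+1}$ if $n$ is odd and $\mathbb{R}^{n+2}$ if $n$ is even. In particular: $K_n$ embeds in $\mathbb{R}^{n+2}$ for all $n$; if $n$ is odd it embeds in $\mathbb{R}^{n+1}$ but not in $\mathbb{R}^n$; and if $n$ is even it does not embed in $\mathbb{R}^{n+1}$. -/

import Mathlib

noncomputable section

/-- Complex conjugation on the unit circle. -/
def Circle.conj (z : Circle) : Circle :=
  ⟨starRingEnd ℂ z, by
    have := z.2
    simp only [Submonoid.unitSphere, Submonoid.mem_mk, Subsemigroup.mem_mk] at *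
    simp_all [mem_sphere_zero_iff_norm]⟩

/-- Negation on the unit circle. -/
def Circle.neg (z : Circle) : Circle :=
  ⟨-(z : ℂ), by
    have := z.2
    simp only [Submonoid.unitSphere, Submonoid.mem_mk, Subsemigroup.mem_mk] at *
    simp_all [mem_sphere_zero_iff_norm]⟩

/-- The torus `(S¹)ⁿ`. -/
abbrev Torus (n : ℕ) : Type := Fin n → Circle

/-- The involution `(z₁,…,z_{n-1},z_n) ↦ (z̄₁,…,z̄_{n-1},-z_n)` on the torus. -/
def kleinInvolution (n : ℕ) (z : Torus n) : Torus n :=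
  fun i => if (i : ℕ) + 1 = n then (z i).neg else (z i).conj

/-- The identification defining the `n`-dimensional Klein bottle. -/
def KleinRel (n : ℕ) (z w : Torus n) : Prop := w = kleinInvolution n z

/-- The `n`-dimensional Klein bottle `Kₙ = (S¹)ⁿ/((z,z_n) ∼ (z̄,-z_n))`. -/
def Klein (n : ℕ) : Type := Quot (KleinRel n)

instance (n : ℕ) : TopologicalSpace (Klein n) := instTopologicalSpaceQuot

section CubicalCochains

variable {ι : Type*} [DecidableEq ι]

/-- A symmetric function summed over ordered pairs of distinct elements vanishes modulo two. -/
theorem sum_offDiag_eq_zero_of_symm (J : Finset ι) (f : ι → ι → ZMod 2)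
    (hf : ∀ i j, f i j = f j i) : ∑ i ∈ J, ∑ j ∈ J.erase i, f i j = 0 := by
  rw [Finset.sum_sigma']
  refine Finset.sum_involution (fun p _ => ⟨p.2, p.1⟩) ?_ ?_ ?_ ?_
  · rintro ⟨i, j⟩ _
    simp only [hf j i]
    exact CharTwo.add_self_eq_zero _
  · rintro ⟨i, j⟩ h _
    simp only [Finset.mem_sigma, Finset.mem_erase] at h
    intro h2
    simp only [Sigma.mk.injEq] at h2
    exact h.2.1 h2.1
  · rintro ⟨i, j⟩ h
    simp only [Finset.mem_sigma, Finset.mem_erase] at h ⊢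
    exact ⟨h.2.2, fun e => h.2.1 e.symm, h.1⟩
  · rintro ⟨i, j⟩ h
    rfl

/-- The top vertex of the unit grid cube with bottom vertex `x` and directions `J`. -/
def cubeTop (J : Finset ι) (x : ι → ℕ) : ι → ℕ := fun i => if i ∈ J then x i + 1 else x i

theorem le_cubeTop (J : Finset ι) (x : ι → ℕ) : x ≤ cubeTop J x := fun i => by
  simp only [cubeTop]; split_ifs <;> omega

theorem cubeTop_mem_Icc (J : Finset ι) (x : ι → ℕ) : cubeTop J x ∈ Set.Icc x (cubeTop J x) :=
  ⟨le_cubeTop J x, le_rfl⟩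

theorem cubeTop_erase_le (J : Finset ι) (j : ι) (x : ι → ℕ) :
    cubeTop (J.erase j) x ≤ cubeTop J x := fun i => by
  simp only [cubeTop, Finset.mem_erase]
  split_ifs with h h' h'
  · exact le_rfl
  · exact absurd h.2 h'
  · exact Nat.le_succ _
  · exact le_rfl

theorem cubeTop_erase_update {J : Finset ι} {j : ι} (hj : j ∈ J) (x : ι → ℕ) :
    cubeTop (J.erase j) (Function.update x j (x j + 1)) = cubeTop J x := by
  funext i
  by_cases h : i = j
  · subst h; simp [cubeTop, hj]
  · simp [cubeTop, h]

/-- The coboundary of a cubical cochain modulo two on the integer grid. -/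
def cubeCoboundary (V : Finset ι → (ι → ℕ) → ZMod 2) (J : Finset ι) (x : ι → ℕ) : ZMod 2 :=
  ∑ j ∈ J, (V (J.erase j) x + V (J.erase j) (Function.update x j (x j + 1)))

theorem cubeCoboundary_add (V W : Finset ι → (ι → ℕ) → ZMod 2) (J : Finset ι) (x : ι → ℕ) :
    cubeCoboundary (fun J x => V J x + W J x) J x =
      cubeCoboundary V J x + cubeCoboundary W J x := by
  simp only [cubeCoboundary, ← Finset.sum_add_distrib]
  exact Finset.sum_congr rfl fun j _ => by ring

theorem cubeCoboundary_cubeCoboundary (V : Finset ι → (ι → ℕ) → ZMod 2) (J : Finset ι)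
    (x : ι → ℕ) : cubeCoboundary (cubeCoboundary V) J x = 0 := by
  simp only [cubeCoboundary, ← Finset.sum_add_distrib]
  have key : ∀ i ∈ J, ∀ j ∈ J.erase i,
      V ((J.erase i).erase j) x + V ((J.erase i).erase j) (Function.update x j (x j + 1)) +
        (V ((J.erase i).erase j) (Function.update x i (x i + 1)) +
          V ((J.erase i).erase j) (Function.update (Function.update x i (x i + 1)) j
            (Function.update x i (x i + 1) j + 1))) =
      V ((J.erase i).erase j) x + (V ((J.erase i).erase j) (Function.update x j (x j + 1)) +
        V ((J.erase i).erase j) (Function.update x i (x i + 1))) +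
          V ((J.erase i).erase j) (fun l => if l = i ∨ l = j then x l + 1 else x l) := by
    intro i _ j hj
    have hji := Finset.ne_of_mem_erase hj
    have : Function.update (Function.update x i (x i + 1)) j
        (Function.update x i (x i + 1) j + 1) =
        fun l => if l = i ∨ l = j then x l + 1 else x l := by
      funext l
      by_cases h1 : l = j
      · subst h1; simp [hji]
      · by_cases h2 : l = i
        · subst h2; simp [h1]
        · simp [h1, h2]
    rw [this]; ring
  rw [Finset.sum_congr rfl fun i hi => Finset.sum_congr rfl (key i hi)]
  apply sum_offDiag_eq_zero_of_symm J (fun i j =>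
      V ((J.erase i).erase j) x + (V ((J.erase i).erase j) (Function.update x j (x j + 1)) +
        V ((J.erase i).erase j) (Function.update x i (x i + 1))) +
          V ((J.erase i).erase j) (fun l => if l = i ∨ l = j then x l + 1 else x l))
  intro i j
  rw [Finset.erase_right_comm]
  simp only [or_comm (a := _ = i)]
  ring

/-- The cubical cup product `δh₀ ∪ δh₁ ∪ ⋯ ∪ δh₍ₖ₋₁₎`. -/
def cupPower (h : ℕ → (ι → ℕ) → ZMod 2) : ℕ → Finset ι → (ι → ℕ) → ZMod 2
  | 0 => fun _ _ => 1
  | k + 1 => cubeCoboundary fun J x => cupPower h k J x * h k (cubeTop J x)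

theorem cubeCoboundary_cupPower (h : ℕ → (ι → ℕ) → ZMod 2) (k : ℕ) (J : Finset ι) (x : ι → ℕ) :
    cubeCoboundary (cupPower h k) J x = 0 := by
  cases k with
  | zero =>
    refine Finset.sum_eq_zero fun j _ => ?_
    simp only [cupPower]
    exact CharTwo.add_self_eq_zero _
  | succ k => exact cubeCoboundary_cubeCoboundary _ J x

theorem cupPower_eq_zero (h : ℕ → (ι → ℕ) → ZMod 2) (k : ℕ) : ∀ (J : Finset ι) (x : ι → ℕ)
    (i : ℕ), i < k → (∀ y ∈ Set.Icc x (cubeTop J x), h i y = h i x) → cupPower h k J x = 0 := by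
  induction k with
  | zero => intro J x i hi; omega
  | succ k ih =>
    intro J x i hi hc
    have hup : ∀ j, x ≤ Function.update x j (x j + 1) := fun j => by simp
    rcases Nat.lt_succ_iff_lt_or_eq.1 hi with hik | rfl
    · refine Finset.sum_eq_zero fun j hj => ?_
      beta_reduce
      rw [ih (J.erase j) x i hik fun y hy => hc y ⟨hy.1, hy.2.trans (cubeTop_erase_le J j x)⟩,
        ih (J.erase j) (Function.update x j (x j + 1)) i hik]
      · simp
      · intro y hy
        rw [cubeTop_erase_update hj] at hy
        rw [hc y ⟨(hup j).trans hy.1, hy.2⟩, hc (Function.update x j (x j + 1))]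
        refine ⟨hup j, ?_⟩
        rw [← cubeTop_erase_update hj]
        exact le_cubeTop _ _
    · have : cupPower h (i + 1) J x = h i x * cubeCoboundary (cupPower h i) J x := by
        simp only [cupPower, cubeCoboundary, Finset.mul_sum]
        refine Finset.sum_congr rfl fun j hj => ?_
        rw [cubeTop_erase_update hj, hc (cubeTop J x) ⟨le_cubeTop _ _, le_rfl⟩,
          hc (cubeTop (J.erase j) x) ⟨le_cubeTop _ _, cubeTop_erase_le J j x⟩]
        ring
      rw [this, cubeCoboundary_cupPower, mul_zero]

theorem cupPower_congr {h h' : ℕ → (ι → ℕ) → ZMod 2} (k : ℕ) : ∀ (J : Finset ι) (x : ι → ℕ),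
    (∀ i, ∀ y ∈ Set.Icc x (cubeTop J x), h' i y = h i y) →
      cupPower h' k J x = cupPower h k J x := by
  induction k with
  | zero => intro J x _; rfl
  | succ k ih =>
    intro J x hc
    have hup : ∀ j, x ≤ Function.update x j (x j + 1) := fun j => by simp
    refine Finset.sum_congr rfl fun j hj => ?_
    beta_reduce
    rw [ih (J.erase j) x fun i y hy => hc i y ⟨hy.1, hy.2.trans (cubeTop_erase_le J j x)⟩,
      ih (J.erase j) (Function.update x j (x j + 1)), cubeTop_erase_update hj,
      hc k (cubeTop J x) ⟨le_cubeTop _ _, le_rfl⟩,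
      hc k (cubeTop (J.erase j) x) ⟨le_cubeTop _ _, cubeTop_erase_le J j x⟩]
    intro i y hy
    rw [cubeTop_erase_update hj] at hy
    exact hc i y ⟨(hup j).trans hy.1, hy.2⟩

theorem cupPower_add_one (h : ℕ → (ι → ℕ) → ZMod 2) (k : ℕ) :
    cupPower (fun i x => h i x + 1) k = cupPower h k := by
  induction k with
  | zero => rfl
  | succ k ih =>
    funext J x
    have : cupPower (fun i x => h i x + 1) (k + 1) J x =
        cubeCoboundary (fun J x => cupPower h k J x * h k (cubeTop J x) + cupPower h k J x)
          J x := by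
      simp only [cupPower, ih, mul_add, mul_one]
    rw [this, cubeCoboundary_add, cubeCoboundary_cupPower, add_zero]
    rfl

theorem cupPower_update (h : ℕ → (ι → ℕ) → ZMod 2) (a : ι) (t : ℕ) (k : ℕ) :
    ∀ (J : Finset ι) (x : ι → ℕ), a ∉ J → cupPower h k J (Function.update x a t) =
      cupPower (fun i y => h i (Function.update y a t)) k J x := by
  induction k with
  | zero => intro J x _; rfl
  | succ k ih =>
    intro J x ha
    have htop : ∀ (J : Finset ι) (x : ι → ℕ), a ∉ J →
        cubeTop J (Function.update x a t) = Function.update (cubeTop J x) a t := by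
      intro J x ha
      funext i
      by_cases h : i = a
      · subst h; simp [cubeTop, ha]
      · simp [cubeTop, h]
    refine Finset.sum_congr rfl fun j hj => ?_
    have hja : j ≠ a := fun e => ha (e ▸ hj)
    have ha' : a ∉ J.erase j := fun h' => ha (Finset.mem_of_mem_erase h')
    beta_reduce
    rw [Function.update_of_ne hja, Function.update_comm hja.symm, ih _ _ ha', ih _ _ ha',
      htop _ _ ha', htop _ _ ha']

variable [Fintype ι] (N : ℕ)

/-- Bottom vertices of the unit cubes subdividing the cube of side `N` with directions `J`. -/
def gridBox (J : Finset ι) (b : ι → ℕ) : Finset (ι → ℕ) :=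
  Fintype.piFinset fun i => if i ∈ J then Finset.range N else {b i}

variable {N} in
theorem mem_gridBox {J : Finset ι} {b x : ι → ℕ} :
    x ∈ gridBox N J b ↔ (∀ i ∈ J, x i < N) ∧ ∀ i ∉ J, x i = b i := by
  simp only [gridBox, Fintype.mem_piFinset]
  constructor
  · intro h
    refine ⟨fun i hi => by simpa [hi] using h i, fun i hi => by simpa [hi] using h i⟩
  · intro h i
    by_cases hi : i ∈ J
    · simpa [hi] using h.1 i hi
    · simpa [hi] using h.2 i hi

theorem sum_gridBox_erase_update {J : Finset ι} (j : ι) (b : ι → ℕ) (a : ℕ)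
    (F : (ι → ℕ) → ZMod 2) :
    ∑ x ∈ gridBox N (J.erase j) (Function.update b j a), F x =
      ∑ x ∈ gridBox N (J.erase j) (Function.update b j 0), F (Function.update x j a) := by
  refine Finset.sum_bij' (fun x _ => Function.update x j 0) (fun x _ => Function.update x j a)
    ?_ ?_ ?_ ?_ ?_
  · intro x hx
    rw [mem_gridBox] at hx ⊢
    refine ⟨fun i hi => ?_, fun i hi => ?_⟩
    · rw [Function.update_of_ne (Finset.ne_of_mem_erase hi)]; exact hx.1 i hi
    · by_cases h : i = j
      · subst h; simp
      · rw [Function.update_of_ne h, Function.update_of_ne h, hx.2 i hi, Function.update_of_ne h]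
  · intro x hx
    rw [mem_gridBox] at hx ⊢
    refine ⟨fun i hi => ?_, fun i hi => ?_⟩
    · rw [Function.update_of_ne (Finset.ne_of_mem_erase hi)]; exact hx.1 i hi
    · by_cases h : i = j
      · subst h; simp
      · rw [Function.update_of_ne h, Function.update_of_ne h, hx.2 i hi, Function.update_of_ne h]
  · intro x hx
    have := (mem_gridBox.1 hx).2 j (by simp)
    simp at this
    simp [← this]
  · intro x hx
    have := (mem_gridBox.1 hx).2 j (by simp)
    simp at this
    simp [← this]
  · intro x hx
    have := (mem_gridBox.1 hx).2 j (by simp)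
    simp at this
    simp [← this]

theorem sum_gridBox_eq_sum_erase {J : Finset ι} {j : ι} (hj : j ∈ J) (b : ι → ℕ)
    (F : (ι → ℕ) → ZMod 2) :
    ∑ x ∈ gridBox N J b, F x = ∑ x ∈ gridBox N (J.erase j) (Function.update b j 0),
      ∑ t ∈ Finset.range N, F (Function.update x j t) := by
  rw [Finset.sum_sigma']
  refine Finset.sum_bij' (fun x _ => ⟨Function.update x j 0, x j⟩)
    (fun p _ => Function.update p.1 j p.2) ?_ ?_ ?_ ?_ ?_
  · intro x hx
    rw [mem_gridBox] at hx
    simp only [Finset.mem_sigma, mem_gridBox, Finset.mem_range]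
    refine ⟨⟨fun i hi => ?_, fun i hi => ?_⟩, hx.1 j hj⟩
    · rw [Function.update_of_ne (Finset.ne_of_mem_erase hi)]
      exact hx.1 i (Finset.mem_of_mem_erase hi)
    · by_cases h : i = j
      · subst h; simp
      · rw [Function.update_of_ne h, Function.update_of_ne h]
        exact hx.2 i fun h' => hi (Finset.mem_erase.2 ⟨h, h'⟩)
  · rintro ⟨x, t⟩ hx
    simp only [Finset.mem_sigma, mem_gridBox, Finset.mem_range] at hx ⊢
    refine ⟨fun i hi => ?_, fun i hi => ?_⟩
    · by_cases h : i = j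
      · subst h; simpa using hx.2
      · rw [Function.update_of_ne h]; exact hx.1.1 i (Finset.mem_erase.2 ⟨h, hi⟩)
    · have h : i ≠ j := fun h => hi (h ▸ hj)
      have := hx.1.2 i fun h' => hi (Finset.mem_of_mem_erase h')
      rw [Function.update_of_ne h] at this ⊢
      exact this
  · intro x _; simp
  · rintro ⟨x, t⟩ hx
    simp only [Finset.mem_sigma, mem_gridBox] at hx
    have := hx.1.2 j (by simp)
    simp at this
    simp [← this]
  · intro x _; simp

theorem sum_range_add_succ (g : ℕ → ZMod 2) (N : ℕ) :
    ∑ t ∈ Finset.range N, (g t + g (t + 1)) = g 0 + g N := by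
  induction N with
  | zero => simp [CharTwo.add_self_eq_zero]
  | succ N ih =>
    rw [Finset.sum_range_succ, ih]
    linear_combination CharTwo.add_self_eq_zero (g N)

theorem sum_gridBox_cubeCoboundary (V : Finset ι → (ι → ℕ) → ZMod 2) (J : Finset ι) (b : ι → ℕ) :
    ∑ x ∈ gridBox N J b, cubeCoboundary V J x =
      ∑ j ∈ J, (∑ x ∈ gridBox N (J.erase j) (Function.update b j 0), V (J.erase j) x +
        ∑ x ∈ gridBox N (J.erase j) (Function.update b j N), V (J.erase j) x) := by
  simp only [cubeCoboundary]
  rw [Finset.sum_comm]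
  refine Finset.sum_congr rfl fun j hj => ?_
  rw [sum_gridBox_eq_sum_erase N hj, sum_gridBox_erase_update N j b N,
    sum_gridBox_erase_update N j b 0 (V (J.erase j)), ← Finset.sum_add_distrib]
  refine Finset.sum_congr rfl fun x _ => ?_
  rw [← sum_range_add_succ (fun t => V (J.erase j) (Function.update x j t))]
  simp

/-- The cochain `δh₀ ∪ ⋯ ∪ δh₍ₖ₋₁₎ ∪ hₖ` evaluated on a subdivided `k`-cube of side `N`. -/
def signCount (h : ℕ → (ι → ℕ) → ZMod 2) (J : Finset ι) (b : ι → ℕ) : ZMod 2 :=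
  ∑ x ∈ gridBox N J b, cupPower h J.card J x * h J.card (cubeTop J x)

/-- The cochain `δh₀ ∪ ⋯ ∪ δh₍ₖ₋₁₎` evaluated on a subdivided `k`-cube of side `N`. -/
def cupCount (h : ℕ → (ι → ℕ) → ZMod 2) (J : Finset ι) (b : ι → ℕ) : ZMod 2 :=
  ∑ x ∈ gridBox N J b, cupPower h J.card J x

theorem cupCount_eq_sum_faces (h : ℕ → (ι → ℕ) → ZMod 2) {J : Finset ι} (hJ : J.Nonempty)
    (b : ι → ℕ) :
    cupCount N h J b = ∑ j ∈ J, (signCount N h (J.erase j) (Function.update b j 0) +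
      signCount N h (J.erase j) (Function.update b j N)) := by
  obtain ⟨k, hk⟩ : ∃ k, J.card = k + 1 := ⟨J.card - 1, by have := hJ.card_pos; omega⟩
  simp only [cupCount, hk, cupPower]
  rw [sum_gridBox_cubeCoboundary]
  refine Finset.sum_congr rfl fun j hj => ?_
  have : (J.erase j).card = k := by rw [Finset.card_erase_of_mem hj, hk]; rfl
  simp only [signCount, this]

theorem cupCount_empty (h : ℕ → (ι → ℕ) → ZMod 2) (b : ι → ℕ) : cupCount N h ∅ b = 1 := by
  have : gridBox N ∅ b = {b} := by
    ext x; rw [mem_gridBox]; simp [funext_iff]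
  simp [cupCount, this, cupPower]

variable {N} in
theorem Icc_cubeTop_of_mem_gridBox {J : Finset ι} {b x y : ι → ℕ} (hx : x ∈ gridBox N J b)
    (hy : y ∈ Set.Icc x (cubeTop J x)) : (∀ i ∈ J, y i ≤ N) ∧ ∀ i ∉ J, y i = b i := by
  rw [mem_gridBox] at hx
  refine ⟨fun i hi => ?_, fun i hi => ?_⟩
  · have := hy.2 i
    have := hx.1 i hi
    simp only [cubeTop, hi] at *
    simp at *; omega
  · have h1 := hy.2 i
    have h2 := hy.1 i
    have := hx.2 i hi
    simp only [cubeTop, hi] at *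
    simp at *; omega

variable {N} in
theorem signCount_congr {h h' : ℕ → (ι → ℕ) → ZMod 2} {J : Finset ι} {b b' : ι → ℕ}
    (hb : ∀ i ∉ J, b' i = b i)
    (hc : ∀ k y, (∀ i ∈ J, y i ≤ N) → (∀ i ∉ J, y i = b i) → h' k y = h k y) :
    signCount N h' J b' = signCount N h J b := by
  have hbox : gridBox N J b' = gridBox N J b := by
    ext x; simp only [mem_gridBox]
    refine and_congr_right fun _ => forall₂_congr fun i hi => by rw [hb i hi]
  rw [signCount, hbox]
  refine Finset.sum_congr rfl fun x hx => ?_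
  rw [cupPower_congr (h := h) (h' := h') _ J x fun i y hy =>
    hc i y (Icc_cubeTop_of_mem_gridBox hx hy).1 (Icc_cubeTop_of_mem_gridBox hx hy).2]
  have := Icc_cubeTop_of_mem_gridBox hx (cubeTop_mem_Icc J x)
  rw [hc _ _ this.1 this.2]

theorem signCount_update (h : ℕ → (ι → ℕ) → ZMod 2) {A : Finset ι} {a : ι} (ha : a ∉ A)
    (b : ι → ℕ) (t : ℕ) : signCount N h A (Function.update b a t) =
      signCount N (fun k x => h k (Function.update x a t)) A (Function.update b a 0) := by
  have := sum_gridBox_erase_update N (J := A) a b t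
    (fun x => cupPower h A.card A x * h A.card (cubeTop A x))
  rw [Finset.erase_eq_of_notMem ha] at this
  rw [signCount, this, signCount]
  refine Finset.sum_congr rfl fun x _ => ?_
  rw [cupPower_update h a t _ _ _ ha]
  congr 2
  funext i
  by_cases h : i = a
  · subst h; simp [cubeTop, ha]
  · simp [cubeTop, h]

variable {N} in
theorem signCount_add_signCount {h h' : ℕ → (ι → ℕ) → ZMod 2} {J : Finset ι} {b : ι → ℕ}
    (hc : ∀ k y, (∀ i ∈ J, y i ≤ N) → (∀ i ∉ J, y i = b i) → h' k y = h k y + 1) :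
    signCount N h J b + signCount N h' J b = cupCount N h J b := by
  rw [signCount_congr (h := fun k y => h k y + 1) (fun _ _ => rfl) hc]
  simp only [signCount, cupCount, cupPower_add_one, ← Finset.sum_add_distrib]
  refine Finset.sum_congr rfl fun x _ => ?_
  linear_combination CharTwo.add_self_eq_zero (cupPower h J.card J x * h J.card (cubeTop J x))

end CubicalCochains

section SphereCount

variable {ι : Type*} [DecidableEq ι]

theorem sum_powerset_symmDiff {L D : Finset ι} (hD : D ⊆ L) (F : Finset ι → ZMod 2) :
    ∑ σ ∈ L.powerset, F (symmDiff D σ) = ∑ σ ∈ L.powerset, F σ := by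
  have hmem : ∀ σ ∈ L.powerset, symmDiff D σ ∈ L.powerset := fun σ hσ => by
    rw [Finset.mem_powerset] at hσ ⊢
    intro i hi
    rcases Finset.mem_symmDiff.1 hi with h | h
    · exact hD h.1
    · exact hσ h.1
  exact Finset.sum_nbij' (symmDiff D) (symmDiff D) hmem hmem (by simp) (by simp) (by simp)

theorem sum_powerset_eq_zero_of_symmDiff {L D : Finset ι} (hD : D ⊆ L) (hne : D.Nonempty)
    (F : Finset ι → ZMod 2) (hF : ∀ σ ⊆ L, F (symmDiff D σ) = F σ) :
    ∑ σ ∈ L.powerset, F σ = 0 := by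
  refine Finset.sum_involution (fun σ _ => symmDiff D σ) ?_ ?_ ?_ ?_
  · intro σ hσ
    rw [hF σ (Finset.mem_powerset.1 hσ)]
    exact CharTwo.add_self_eq_zero _
  · intro σ _ _ h
    rw [symmDiff_eq_right] at h
    exact hne.ne_empty h
  · intro σ hσ
    rw [Finset.mem_powerset] at hσ ⊢
    intro i hi
    rcases Finset.mem_symmDiff.1 hi with h | h
    · exact hD h.1
    · exact hσ h.1
  · simp

theorem sum_powerset_insert_symmDiff {L : Finset ι} {m : ι} (hm : m ∉ L)
    (F : Finset ι → ZMod 2) :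
    ∑ σ ∈ (insert m L).powerset, F σ =
      ∑ σ ∈ L.powerset, (F σ + F (symmDiff (insert m L) σ)) := by
  rw [Finset.sum_powerset_insert hm, 
    ← sum_powerset_symmDiff (subset_refl L) (fun σ => F (insert m σ))]
  rw [Finset.sum_add_distrib]
  congr 1
  refine Finset.sum_congr rfl fun σ hσ => congrArg F ?_
  have hmσ : m ∉ σ := fun h => hm (Finset.mem_powerset.1 hσ h)
  ext i
  by_cases h : i = m
  · subst h; simp [Finset.mem_symmDiff, hmσ]
  · simp [Finset.mem_symmDiff, h]

/-- Change the signs of the coordinates in `σ`. -/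
def negOn (σ : Finset ι) (v : ι → ℤ) : ι → ℤ := fun i => if i ∈ σ then -v i else v i

/-- A labelling of the integer lattice restricted to the orthant with signs `σ`. -/
def orthantLabel (h : ℕ → (ι → ℤ) → ZMod 2) (σ : Finset ι) : ℕ → (ι → ℕ) → ZMod 2 :=
  fun k x => h k (negOn σ fun i => (x i : ℤ))

variable [Fintype ι] (N : ℕ)

/-- The sum of `signCount` over the cube sphere with coordinates `J` times the cube with
coordinates `Φ`. -/
def sphereCount (h : ℕ → (ι → ℤ) → ZMod 2) (Φ J : Finset ι) : ZMod 2 :=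
  ∑ σ ∈ J.powerset, ∑ i ∈ J, signCount N (orthantLabel h σ) (Φ ∪ J.erase i) (Pi.single i N)

theorem sum_cupCount_faces (h : ℕ → (ι → ℕ) → ZMod 2) {Φ J : Finset ι} (hd : Disjoint Φ J)
    (hne : ∀ i ∈ J, (Φ ∪ J.erase i).Nonempty) :
    ∑ i ∈ J, cupCount N h (Φ ∪ J.erase i) (Pi.single i N) =
      ∑ i ∈ J, ∑ j ∈ Φ, (signCount N h (Φ.erase j ∪ J.erase i) (Pi.single i N) +
        signCount N h (Φ.erase j ∪ J.erase i) (Function.update (Pi.single i N) j N)) +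
      ∑ i ∈ J, ∑ j ∈ J.erase i, signCount N h (Φ ∪ (J.erase i).erase j) (Pi.single i N) := by
  have hsymm := sum_offDiag_eq_zero_of_symm J
    (fun i j => signCount N h (Φ ∪ (J.erase i).erase j)
      (fun a => if a = i ∨ a = j then N else 0)) (fun i j => by
        rw [Finset.erase_right_comm]
        simp only [or_comm])
  rw [← add_zero (∑ i ∈ J, ∑ j ∈ J.erase i, signCount N h _ _), ← hsymm]
  simp only [← Finset.sum_add_distrib]
  refine Finset.sum_congr rfl fun i hi => ?_
  have hdi : Disjoint Φ (J.erase i) := hd.mono_right (Finset.erase_subset _ _)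
  have hup0 : ∀ j, j ≠ i → Function.update (Pi.single i N : ι → ℕ) j 0 = Pi.single i N := by
    intro j hj
    apply Function.update_eq_self_iff.2
    simp [hj]
  rw [cupCount_eq_sum_faces N h (hne i hi), Finset.sum_union hdi]
  congr 1
  · refine Finset.sum_congr rfl fun j hj => ?_
    have hjJ : j ∉ J := Finset.disjoint_left.1 hd hj
    have : (Φ ∪ J.erase i).erase j = Φ.erase j ∪ J.erase i := by
      rw [Finset.erase_union_distrib, Finset.erase_eq_of_notMem (a := j) (s := J.erase i)]
      exact fun h' => hjJ (Finset.mem_of_mem_erase h')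
    rw [this, hup0 j (fun h' => hjJ (h' ▸ hi))]
  · refine Finset.sum_congr rfl fun j hj => ?_
    have hjΦ : j ∉ Φ := Finset.disjoint_right.1 hdi hj
    have : (Φ ∪ J.erase i).erase j = Φ ∪ (J.erase i).erase j := by
      rw [Finset.erase_union_distrib, Finset.erase_eq_of_notMem hjΦ]
    rw [this, hup0 j (Finset.ne_of_mem_erase hj)]
    congr 2
    funext a
    by_cases h1 : a = j
    · simp [h1]
    · by_cases h2 : a = i
      · subst h2; simp [h1]
      · simp [h1, h2]

/-- The symmetries of a labelling coming from pairs of distinct points of a mapping torus of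
the inversion of a torus. The coordinates in `K` describe the difference of the two points,
`φ` is the position along a circle, and `r` is a homotopy parameter. -/
structure PairLabelling (K : Finset ι) (l φ r : ι) (h : ℕ → (ι → ℤ) → ZMod 2) : Prop where
  l_mem : l ∈ K
  φ_notMem : φ ∉ K
  r_notMem : r ∉ K
  φ_ne_r : φ ≠ r
  antipode : ∀ (k : ℕ) (v : ι → ℤ), (∀ i, |v i| ≤ N) → v r = 0 → (∃ i ∈ K, v i ≠ 0) →
    h k (negOn K v) = h k v + 1
  glue : ∀ (k : ℕ) (v : ι → ℤ), v φ = N → h k (negOn (K.erase l) (Function.update v φ 0)) = h k v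
  fold : ∀ (k : ℕ) (v : ι → ℤ), v r = N → ∀ i ∈ K.erase l, |v i| = N → h k (negOn {i} v) = h k v
  fold_last : ∀ (k : ℕ) (v : ι → ℤ), v r = N → |v l| = N → h k (negOn K v) = h k v

variable {N} {K : Finset ι} {l φ r : ι} {h : ℕ → (ι → ℤ) → ZMod 2}

omit [Fintype ι] in
theorem negOn_symmDiff (D σ : Finset ι) (v : ι → ℤ) :
    negOn (symmDiff D σ) v = negOn D (negOn σ v) := by
  funext i
  by_cases h1 : i ∈ D <;> by_cases h2 : i ∈ σ <;> simp [negOn, Finset.mem_symmDiff, h1, h2]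

omit [Fintype ι] in
theorem negOn_congr {D D' : Finset ι} {v : ι → ℤ} (hv : ∀ i, v i ≠ 0 → (i ∈ D ↔ i ∈ D')) :
    negOn D v = negOn D' v := by
  funext i
  by_cases h0 : v i = 0
  · simp [negOn, h0]
  · simp [negOn, hv i h0]

omit [Fintype ι] in
theorem abs_negOn (D : Finset ι) (v : ι → ℤ) (i : ι) : |negOn D v i| = |v i| := by
  simp only [negOn]; split_ifs <;> simp

theorem sum_orthant_flip_eq_zero {L A : Finset ι} {b : ι → ℕ} {j : ι} (hj : j ∈ L)
    (hA : j ∉ A) (hb : b j = 0) :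
    ∑ σ ∈ L.powerset, signCount N (orthantLabel h σ) A b = 0 := by
  refine sum_powerset_eq_zero_of_symmDiff (D := {j}) (by simpa using hj) (by simp) _ ?_
  intro σ _
  refine signCount_congr (fun _ _ => rfl) fun k y _ hy => ?_
  simp only [orthantLabel]
  rw [symmDiff_comm, negOn_symmDiff]
  congr 2
  funext i
  by_cases hij : i = j
  · subst hij; simp [negOn, hy i hA, hb]
  · simp [negOn, hij]

theorem PairLabelling.sphereCount_insert (H : PairLabelling N K l φ r h) (hN : 0 < N)
    {Φ J : Finset ι} {m : ι} (hm : m ∉ J) (hJ : insert m J ⊆ K) (hΦ : r ∉ Φ)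
    (hΦK : Disjoint Φ K) :
    sphereCount N h Φ (insert m J) = ∑ σ ∈ J.powerset, ∑ i ∈ insert m J,
      cupCount N (orthantLabel h σ) (Φ ∪ (insert m J).erase i) (Pi.single i N) := by
  rw [sphereCount, sum_powerset_insert_symmDiff hm]
  refine Finset.sum_congr rfl fun σ hσ => ?_
  rw [← Finset.sum_add_distrib]
  refine Finset.sum_congr rfl fun i hi => signCount_add_signCount fun k y hy1 hy2 => ?_
  have hσJ : σ ⊆ insert m J := (Finset.mem_powerset.1 hσ).trans (Finset.subset_insert _ _)
  have hiΦ : i ∉ Φ := Finset.disjoint_right.1 hΦK (hJ hi)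
  have hyi : y i = N := by rw [hy2 i (by simp [hiΦ])]; simp
  have hri : r ≠ i := fun e => H.r_notMem (e ▸ hJ hi)
  simp only [orthantLabel]
  rw [← H.antipode k (negOn σ fun i => (y i : ℤ))]
  · rw [negOn_symmDiff]
    congr 1
    refine negOn_congr fun a ha => ⟨fun h' => hJ h', fun h' => ?_⟩
    by_contra h''
    refine ha ?_
    have haΦ : a ∉ Φ := Finset.disjoint_right.1 hΦK h'
    have hai : a ≠ i := fun e => h'' (e ▸ hi)
    have : y a = 0 := by
      rw [hy2 a (by simp only [Finset.mem_union, Finset.mem_erase]; tauto)]; simp [hai]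
    simp [negOn, this]
  · intro a
    rw [abs_negOn]
    by_cases ha : a ∈ Φ ∪ (insert m J).erase i
    · have := hy1 a ha
      simpa using this
    · rw [hy2 a ha]
      by_cases hai : a = i
      · subst hai; simp
      · simp [hai]
  · have : r ∉ insert m J := fun h' => H.r_notMem (hJ h')
    have hy : y r = 0 := by
      rw [hy2 r (by simp only [Finset.mem_union, Finset.mem_erase]; tauto)]; simp [hri]
    simp [negOn, hy]
  · refine ⟨i, hJ hi, ?_⟩
    rw [← abs_ne_zero, abs_negOn]
    simp [hyi, hN.ne']

/-- Faces of a hemisphere in directions of the sphere give the equator. -/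
theorem sum_sphere_faces {Φ J : Finset ι} {m : ι} (hm : m ∉ J) (hΦ : Disjoint Φ (insert m J)) :
    ∑ σ ∈ J.powerset, ∑ i ∈ insert m J, ∑ j ∈ (insert m J).erase i,
      signCount N (orthantLabel h σ) (Φ ∪ ((insert m J).erase i).erase j) (Pi.single i N) =
    sphereCount N h Φ J := by
  rw [Finset.sum_comm]
  have h1 : ∀ i ∈ insert m J, ∑ σ ∈ J.powerset, ∑ j ∈ (insert m J).erase i,
      signCount N (orthantLabel h σ) (Φ ∪ ((insert m J).erase i).erase j) (Pi.single i N) =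
      if i = m then 0 else ∑ σ ∈ J.powerset,
        signCount N (orthantLabel h σ) (Φ ∪ J.erase i) (Pi.single i N) := by
    intro i hi
    rw [Finset.sum_comm]
    have h2 : ∀ j ∈ (insert m J).erase i, j ≠ m → ∑ σ ∈ J.powerset,
        signCount N (orthantLabel h σ) (Φ ∪ ((insert m J).erase i).erase j) (Pi.single i N) =
        0 := by
      intro j hj hjm
      have hj' := Finset.mem_erase.1 hj
      refine sum_orthant_flip_eq_zero ((Finset.mem_insert.1 hj'.2).resolve_left hjm) ?_ ?_
      · simp [Finset.disjoint_right.1 hΦ hj'.2]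
      · simp [hj'.1]
    split_ifs with him
    · subst him
      exact Finset.sum_eq_zero fun j hj => h2 j hj (Finset.ne_of_mem_erase hj)
    · rw [Finset.sum_eq_single m h2 (fun h' => absurd (Finset.mem_erase.2
        ⟨fun e => him e.symm, Finset.mem_insert_self m J⟩) h'), Finset.erase_right_comm,
        Finset.erase_insert hm]
  rw [Finset.sum_congr rfl h1, Finset.sum_insert hm, if_pos rfl, zero_add, sphereCount,
    Finset.sum_comm]
  refine Finset.sum_congr rfl fun i hi => if_neg ?_
  rintro rfl
  exact hm hi

theorem PairLabelling.sphereCount_empty (H : PairLabelling N K l φ r h) (hN : 0 < N)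
    (J : Finset ι) (hJ : J ⊆ K) (hne : J.Nonempty) : sphereCount N h ∅ J = 1 := by
  induction J using Finset.induction_on with
  | empty => exact absurd hne (by simp)
  | insert m J hm ih =>
    rw [H.sphereCount_insert hN hm hJ (by simp) (by simp)]
    rcases J.eq_empty_or_nonempty with rfl | hJne
    · simp [cupCount_empty]
    · rw [← ih ((Finset.subset_insert _ _).trans hJ) hJne, ← sum_sphere_faces hm (by simp)]
      refine Finset.sum_congr rfl fun σ _ => ?_
      rw [sum_cupCount_faces N _ (by simp)]
      · simp
      · intro i hi
        rw [Finset.empty_union]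
        by_cases him : i = m
        · subst him; simpa [Finset.erase_insert hm] using hJne
        · exact ⟨m, Finset.mem_erase.2 ⟨fun e => him e.symm, Finset.mem_insert_self m J⟩⟩

theorem PairLabelling.glue_signCount (H : PairLabelling N K l φ r h) {A J σ : Finset ι}
    {b : ι → ℕ} (hJ : J ⊆ K) (hσ : σ ⊆ K) (hφ : φ ∉ A) (hbφ : b φ = 0)
    (hb : ∀ i ∈ K, i ∉ J → b i = 0 ∧ i ∉ A) :
    signCount N (orthantLabel h σ) A (Function.update b φ N) =
      signCount N (orthantLabel h (symmDiff (J.erase l) σ)) A b := by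
  rw [signCount_update N _ hφ, ← hbφ, Function.update_eq_self]
  refine signCount_congr (fun _ _ => rfl) fun k y _ hy => ?_
  have hyφ : y φ = 0 := by rw [hy φ hφ, hbφ]
  simp only [orthantLabel]
  rw [← H.glue k]
  · rw [negOn_symmDiff]
    congr 1
    have : Function.update (negOn σ fun i => ((Function.update y φ N i : ℕ) : ℤ)) φ 0 =
        negOn σ fun i => (y i : ℤ) := by
      funext i
      by_cases h : i = φ
      · subst h; simp [negOn, hyφ]
      · simp [negOn, h]
    rw [this]
    refine negOn_congr fun i hi => ?_
    simp only [Finset.mem_erase]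
    refine and_congr_right fun _ => ⟨fun hK => ?_, fun h' => hJ h'⟩
    by_contra h'
    refine hi ?_
    have := hb i hK h'
    simp [negOn, hy i this.2, this.1]
  · have : φ ∉ σ := fun h' => H.φ_notMem (hσ h')
    simp [negOn, this]

theorem PairLabelling.sphereCount_singleton (H : PairLabelling N K l φ r h) (hN : 0 < N)
    (J : Finset ι) (hJ : J ⊆ K) : sphereCount N h {φ} J = ((J.erase l).card : ZMod 2) := by
  induction J using Finset.induction_on with
  | empty => simp [sphereCount]
  | insert m J hm ih =>
    have hφJ : φ ∉ insert m J := fun h' => H.φ_notMem (hJ h')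
    rw [H.sphereCount_insert hN hm hJ (by simpa using H.φ_ne_r.symm)
      (by simpa using H.φ_notMem)]
    have hfaces : ∀ σ ∈ J.powerset, ∑ i ∈ insert m J, cupCount N (orthantLabel h σ)
        ({φ} ∪ (insert m J).erase i) (Pi.single i N) =
        ∑ i ∈ insert m J, signCount N (orthantLabel h σ) ((insert m J).erase i) (Pi.single i N) +
        ∑ i ∈ insert m J, signCount N (orthantLabel h (symmDiff ((insert m J).erase l) σ))
          ((insert m J).erase i) (Pi.single i N) +
        ∑ i ∈ insert m J, ∑ j ∈ (insert m J).erase i, signCount N (orthantLabel h σ)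
          ({φ} ∪ ((insert m J).erase i).erase j) (Pi.single i N) := by
      intro σ hσ
      rw [sum_cupCount_faces N _ (by simpa using hφJ) (by simp)]
      congr 1
      rw [← Finset.sum_add_distrib]
      refine Finset.sum_congr rfl fun i hi => ?_
      have hφi : φ ≠ i := fun e => hφJ (e ▸ hi)
      simp only [Finset.sum_singleton, Finset.erase_singleton, Finset.empty_union]
      congr 1
      refine H.glue_signCount hJ ?_ ?_ (by simp [hφi]) ?_
      · exact (Finset.mem_powerset.1 hσ).trans ((Finset.subset_insert _ _).trans hJ)
      · exact fun h' => hφJ (Finset.mem_of_mem_erase h')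
      · intro a _ ha
        have hai : a ≠ i := by rintro rfl; exact ha hi
        exact ⟨by simp [hai], fun h' => ha (Finset.mem_of_mem_erase h')⟩
    rw [Finset.sum_congr rfl hfaces, Finset.sum_add_distrib,
      sum_sphere_faces hm (by simpa using hφJ), ih ((Finset.subset_insert _ _).trans hJ)]
    by_cases hml : m = l
    · subst hml
      rw [Finset.erase_insert hm, Finset.sum_add_distrib,
        sum_powerset_symmDiff (subset_refl J) (fun σ => ∑ i ∈ insert m J,
          signCount N (orthantLabel h σ) ((insert m J).erase i) (Pi.single i N)),
        CharTwo.add_self_eq_zero, zero_add, Finset.erase_eq_of_notMem hm]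
    · have h1 := H.sphereCount_empty hN (insert m J) hJ (by simp)
      rw [sphereCount, Finset.sum_powerset_insert hm] at h1
      have h2 : ∑ σ ∈ J.powerset, ∑ i ∈ insert m J,
          signCount N (orthantLabel h (symmDiff ((insert m J).erase l) σ))
            ((insert m J).erase i) (Pi.single i N) =
          ∑ σ ∈ J.powerset, ∑ i ∈ insert m J,
          signCount N (orthantLabel h (insert m σ)) ((insert m J).erase i) (Pi.single i N) := by
        rw [← sum_powerset_symmDiff (Finset.erase_subset l J) (fun σ => ∑ i ∈ insert m J,
          signCount N (orthantLabel h (insert m σ)) ((insert m J).erase i) (Pi.single i N))]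
        refine Finset.sum_congr rfl fun σ hσ => ?_
        have hmσ : m ∉ σ := fun h => hm (Finset.mem_powerset.1 hσ h)
        have : symmDiff ((insert m J).erase l) σ = insert m (symmDiff (J.erase l) σ) := by
          ext i
          by_cases h : i = m
          · subst h; simp [Finset.mem_symmDiff, hmσ, hml]
          · simp [Finset.mem_symmDiff, h]
        rw [this]
      rw [Finset.sum_add_distrib, h2]
      simp only [Finset.empty_union] at h1
      rw [h1, Finset.erase_insert_of_ne hml, Finset.card_insert_of_notMem (by simp [hm])]
      push_cast
      ring

theorem PairLabelling.sum_fold_eq_zero (H : PairLabelling N K l φ r h) {Φ : Finset ι} (hr : r ∉ Φ)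
    (hΦK : Disjoint Φ K) : ∑ σ ∈ K.powerset, ∑ i ∈ K, signCount N (orthantLabel h σ)
      (Φ ∪ K.erase i) (Function.update (Pi.single i N) r N) = 0 := by
  rw [Finset.sum_comm]
  refine Finset.sum_eq_zero fun i hi => ?_
  have hri : r ≠ i := fun e => H.r_notMem (e ▸ hi)
  have hrA : r ∉ Φ ∪ K.erase i := by
    have := H.r_notMem
    simp only [Finset.mem_union, Finset.mem_erase]; tauto
  have hiA : i ∉ Φ ∪ K.erase i := by
    simp [Finset.disjoint_right.1 hΦK hi]
  have hflip : ∀ D ⊆ K, (∀ k (v : ι → ℤ), v r = N → |v i| = N → h k (negOn D v) = h k v) →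
      ∀ σ ⊆ K, signCount N (orthantLabel h (symmDiff D σ)) (Φ ∪ K.erase i)
        (Function.update (Pi.single i N) r N) = signCount N (orthantLabel h σ) (Φ ∪ K.erase i)
        (Function.update (Pi.single i N) r N) := by
    intro D _ hD σ hσ
    refine signCount_congr (fun _ _ => rfl) fun k y _ hy => ?_
    simp only [orthantLabel]
    rw [negOn_symmDiff, hD]
    · have : r ∉ σ := fun h' => H.r_notMem (hσ h')
      simp [negOn, this, hy r hrA]
    · rw [abs_negOn, hy i hiA]
      simp [hri.symm]
  by_cases hil : i = l
  · subst hil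
    exact sum_powerset_eq_zero_of_symmDiff subset_rfl ⟨i, hi⟩ _
      (hflip K subset_rfl fun k v => H.fold_last k v)
  · have hiK : ({i} : Finset ι) ⊆ K := by simpa using hi
    exact sum_powerset_eq_zero_of_symmDiff hiK (by simp) _
      (hflip {i} hiK fun k v hv => H.fold k v hv i (Finset.mem_erase.2 ⟨hil, hi⟩))

theorem sum_sphere_faces_eq_zero {Φ J : Finset ι} (hΦ : Disjoint Φ J) :
    ∑ σ ∈ J.powerset, ∑ i ∈ J, ∑ j ∈ J.erase i,
      signCount N (orthantLabel h σ) (Φ ∪ (J.erase i).erase j) (Pi.single i N) = 0 := by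
  rw [Finset.sum_comm]
  refine Finset.sum_eq_zero fun i hi => ?_
  rw [Finset.sum_comm]
  refine Finset.sum_eq_zero fun j hj => ?_
  have hj' := Finset.mem_erase.1 hj
  refine sum_orthant_flip_eq_zero hj'.2 ?_ ?_
  · simp [Finset.disjoint_right.1 hΦ hj'.2]
  · simp [hj'.1]

theorem PairLabelling.exists_cupCount_ne_zero (H : PairLabelling N K l φ r h) (hN : 0 < N) :
    ∃ σ ⊆ K, ∃ i ∈ K,
      cupCount N (orthantLabel h σ) ({r} ∪ K.erase i) (Pi.single i N) ≠ 0 := by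
  by_contra! hc
  have h0 : ∑ σ ∈ K.powerset, ∑ i ∈ K,
      cupCount N (orthantLabel h σ) ({r} ∪ K.erase i) (Pi.single i N) = 0 :=
    Finset.sum_eq_zero fun σ hσ => Finset.sum_eq_zero fun i hi =>
      hc σ (Finset.mem_powerset.1 hσ) i hi
  have hrK : Disjoint {r} K := by simpa using H.r_notMem
  rw [Finset.sum_congr rfl fun σ _ => sum_cupCount_faces N _ hrK (by simp),
    Finset.sum_add_distrib, sum_sphere_faces_eq_zero hrK] at h0
  simp only [Finset.sum_singleton, Finset.erase_singleton, Finset.sum_add_distrib] at h0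
  rw [H.sum_fold_eq_zero (by simp) (by simp), add_zero, add_zero] at h0
  have := H.sphereCount_empty hN K subset_rfl ⟨l, H.l_mem⟩
  rw [sphereCount, h0] at this
  exact zero_ne_one this

theorem PairLabelling.exists_cupCount_ne_zero_of_even (H : PairLabelling N K l φ r h)
    (hN : 0 < N) (hK : Even K.card) : ∃ σ ⊆ K, ∃ i ∈ K,
      cupCount N (orthantLabel h σ) ({r, φ} ∪ K.erase i) (Pi.single i N) ≠ 0 := by
  by_contra! hc
  have h0 : ∑ σ ∈ K.powerset, ∑ i ∈ K,
      cupCount N (orthantLabel h σ) ({r, φ} ∪ K.erase i) (Pi.single i N) = 0 :=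
    Finset.sum_eq_zero fun σ hσ => Finset.sum_eq_zero fun i hi =>
      hc σ (Finset.mem_powerset.1 hσ) i hi
  have hrK : Disjoint {r, φ} K := by simpa using ⟨H.r_notMem, H.φ_notMem⟩
  rw [Finset.sum_congr rfl fun σ _ => sum_cupCount_faces N _ hrK (by simp),
    Finset.sum_add_distrib, sum_sphere_faces_eq_zero hrK] at h0
  have hrφ : r ∉ ({φ} : Finset ι) := by simpa using H.φ_ne_r.symm
  have hφr : φ ∉ ({r} : Finset ι) := by simpa using H.φ_ne_r
  have e1 : ({r, φ} : Finset ι).erase r = {φ} := Finset.erase_insert hrφ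
  have e2 : ({r, φ} : Finset ι).erase φ = {r} := by
    rw [Finset.pair_comm]; exact Finset.erase_insert hφr
  simp only [Finset.sum_pair H.φ_ne_r.symm, e1, e2, Finset.sum_add_distrib] at h0
  have hglue : ∑ σ ∈ K.powerset, ∑ i ∈ K, signCount N (orthantLabel h σ) ({r} ∪ K.erase i)
        (Function.update (Pi.single i N) φ N) =
      ∑ σ ∈ K.powerset, ∑ i ∈ K, signCount N (orthantLabel h σ) ({r} ∪ K.erase i)
        (Pi.single i N) := by
    rw [← sum_powerset_symmDiff (Finset.erase_subset l K) (fun σ => ∑ i ∈ K,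
      signCount N (orthantLabel h σ) ({r} ∪ K.erase i) (Pi.single i N))]
    refine Finset.sum_congr rfl fun σ hσ => Finset.sum_congr rfl fun i hi => ?_
    have hφi : φ ≠ i := fun e => H.φ_notMem (e ▸ hi)
    refine H.glue_signCount subset_rfl (Finset.mem_powerset.1 hσ) ?_ (by simp [hφi])
      (fun a ha ha' => absurd ha ha')
    have := H.φ_notMem
    simp only [Finset.mem_union, Finset.mem_erase]; tauto
  rw [H.sum_fold_eq_zero hrφ (by simpa using H.φ_notMem), hglue,
    CharTwo.add_self_eq_zero, add_zero, add_zero, add_zero] at h0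
  have := H.sphereCount_singleton hN K subset_rfl
  rw [sphereCount, h0, Finset.card_erase_of_mem H.l_mem] at this
  have hpos : 0 < K.card := Finset.card_pos.2 ⟨l, H.l_mem⟩
  have hodd : Odd (K.card - 1) := Nat.Even.sub_odd hpos hK odd_one
  rw [ZMod.natCast_eq_one_iff_odd.2 hodd] at this
  exact zero_ne_one this

end SphereCount

section Embedding

variable {n : ℕ}

theorem kleinInvolution_apply_of_ne (z : Torus n) {i : Fin n} (hi : (i : ℕ) + 1 ≠ n) :
    ((kleinInvolution n z i : Circle) : ℂ) = starRingEnd ℂ (z i : ℂ) := by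
  simp [kleinInvolution, hi, Circle.conj]

theorem kleinInvolution_apply_last (z : Torus n) {i : Fin n} (hi : (i : ℕ) + 1 = n) :
    ((kleinInvolution n z i : Circle) : ℂ) = -(z i : ℂ) := by
  simp [kleinInvolution, hi, Circle.neg]

/-- The coordinates of a point of the torus, extended by `1`. -/
def torusCoord (z : Torus n) (j : ℕ) : ℂ := if h : j < n then (z ⟨j, h⟩ : ℂ) else 1

theorem norm_torusCoord (z : Torus n) (j : ℕ) : ‖torusCoord z j‖ = 1 := by
  unfold torusCoord
  split_ifs
  · exact Circle.norm_coe _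
  · exact norm_one

theorem continuous_torusCoord (j : ℕ) : Continuous fun z : Torus n => torusCoord z j := by
  unfold torusCoord; split_ifs <;> fun_prop

/-- The distance to the axis in an iterated torus of revolution. -/
def torusRadius (z : Torus n) : ℕ → ℝ
  | 0 => 1
  | j + 1 => Real.exp (torusRadius z j * (torusCoord z j).re)

/-- The height in an iterated torus of revolution. -/
def torusHeight (z : Torus n) (j : ℕ) : ℝ := torusRadius z j * (torusCoord z j).im

theorem torusRadius_pos (z : Torus n) (j : ℕ) : 0 < torusRadius z j := by
  cases j with
  | zero => exact one_pos
  | succ j => exact Real.exp_pos _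

theorem continuous_torusRadius (j : ℕ) : Continuous fun z : Torus n => torusRadius z j := by
  induction j with
  | zero => exact continuous_const
  | succ j ih =>
    exact Real.continuous_exp.comp (ih.mul (Complex.continuous_re.comp (continuous_torusCoord j)))

theorem continuous_torusHeight (j : ℕ) : Continuous fun z : Torus n => torusHeight z j :=
  (continuous_torusRadius j).mul (Complex.continuous_im.comp (continuous_torusCoord j))

theorem torusCoord_kleinInvolution (z : Torus n) {j : ℕ} (hj : j + 1 < n) :
    torusCoord (kleinInvolution n z) j = starRingEnd ℂ (torusCoord z j) := by
  have : j < n := by omega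
  simp only [torusCoord, this, dite_true]
  exact kleinInvolution_apply_of_ne z (by simp; omega)

theorem torusCoord_kleinInvolution_last (z : Torus n) (hn : 1 ≤ n) :
    torusCoord (kleinInvolution n z) (n - 1) = -torusCoord z (n - 1) := by
  have : n - 1 < n := by omega
  simp only [torusCoord, this, dite_true]
  exact kleinInvolution_apply_last z (by simp; omega)

theorem torusRadius_kleinInvolution (z : Torus n) (j : ℕ) (hj : j < n) :
    torusRadius (kleinInvolution n z) j = torusRadius z j := by
  induction j with
  | zero => rfl
  | succ j ih =>
    simp [torusRadius, ih (by omega), torusCoord_kleinInvolution z hj]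

theorem torusHeight_kleinInvolution (z : Torus n) (j : ℕ) (hj : j + 1 < n) :
    torusHeight (kleinInvolution n z) j = -torusHeight z j := by
  simp [torusHeight, torusRadius_kleinInvolution z j (by omega), torusCoord_kleinInvolution z hj]

theorem torusCoord_eq_of_height_eq {z w : Torus n} (m : ℕ)
    (hr : torusRadius z m = torusRadius w m)
    (hh : ∀ j < m, torusHeight z j = torusHeight w j) :
    ∀ j < m, torusCoord z j = torusCoord w j := by
  induction m with
  | zero => intro j hj; omega
  | succ m ih =>
    have hre : torusRadius z m * (torusCoord z m).re = torusRadius w m * (torusCoord w m).re :=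
      Real.exp_injective hr
    have him := hh m (by omega)
    have hc : (torusRadius z m : ℂ) * torusCoord z m = torusRadius w m * torusCoord w m := by
      apply Complex.ext
      · simpa using hre
      · simpa [torusHeight] using him
    have hrm : torusRadius z m = torusRadius w m := by
      have := congrArg norm hc
      simpa [norm_torusCoord, abs_of_pos, torusRadius_pos] using this
    have hcm : torusCoord z m = torusCoord w m := by
      rw [hrm] at hc
      exact mul_left_cancel₀ (by exact_mod_cast (torusRadius_pos w m).ne') hc
    intro j hj
    rcases Nat.lt_succ_iff_lt_or_eq.1 hj with h | rfl
    · exact ih hrm (fun i hi => hh i (by omega)) j h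
    · exact hcm

/-- The heights in the first `n - 1` directions, extended by zero. -/
def kleinHeight (z : Torus n) (j : ℕ) : ℝ := if j + 1 < n then torusHeight z j else 0

theorem kleinHeight_kleinInvolution (z : Torus n) (j : ℕ) :
    kleinHeight (kleinInvolution n z) j = -kleinHeight z j := by
  unfold kleinHeight
  split_ifs with h
  · exact torusHeight_kleinInvolution z j h
  · simp

theorem continuous_kleinHeight (j : ℕ) : Continuous fun z : Torus n => kleinHeight z j := by
  unfold kleinHeight
  split_ifs
  · exact continuous_torusHeight j
  · exact continuous_const

/-- A map on the torus inducing an embedding of the Klein bottle. -/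
def kleinMap (z : Torus n) : ℂ × (Fin (n / 2) → ℂ) :=
  (torusRadius z (n - 1) * torusCoord z (n - 1) ^ 2,
    fun q => (kleinHeight z (2 * q) + kleinHeight z (2 * q + 1) * Complex.I) *
      torusCoord z (n - 1))

theorem continuous_kleinMap : Continuous (kleinMap (n := n)) := by
  have h1 := continuous_torusCoord (n := n) (n - 1)
  have h2 := continuous_torusRadius (n := n) (n - 1)
  have h3 := continuous_kleinHeight (n := n)
  refine Continuous.prodMk ?_ (continuous_pi fun q => ?_)
  · exact (Complex.continuous_ofReal.comp h2).mul (h1.pow 2)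
  · exact (((Complex.continuous_ofReal.comp (h3 _))).add
      ((Complex.continuous_ofReal.comp (h3 _)).mul continuous_const)).mul h1

theorem kleinMap_kleinInvolution (hn : 1 ≤ n) (z : Torus n) :
    kleinMap (kleinInvolution n z) = kleinMap z := by
  unfold kleinMap
  rw [torusCoord_kleinInvolution_last z hn, torusRadius_kleinInvolution z (n - 1) (by omega)]
  simp only [kleinHeight_kleinInvolution]
  refine Prod.ext ?_ (funext fun q => ?_)
  · simp
  · simp only []
    push_cast
    ring

theorem eq_of_kleinMap_eq (hn : 1 ≤ n) {z w : Torus n} (h : kleinMap z = kleinMap w)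
    (hl : torusCoord z (n - 1) = torusCoord w (n - 1)) : z = w := by
  have hne : torusCoord w (n - 1) ≠ 0 := by
    rw [← norm_ne_zero_iff, norm_torusCoord]; exact one_ne_zero
  have h1 := congrArg Prod.fst h
  have h2 := congrArg Prod.snd h
  simp only [kleinMap, hl] at h1 h2
  have hr : torusRadius z (n - 1) = torusRadius w (n - 1) := by
    exact_mod_cast mul_right_cancel₀ (pow_ne_zero 2 hne) h1
  have hq : ∀ q : Fin (n / 2), kleinHeight z (2 * q) = kleinHeight w (2 * q) ∧
      kleinHeight z (2 * q + 1) = kleinHeight w (2 * q + 1) := by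
    intro q
    have := mul_right_cancel₀ hne (congrFun h2 q)
    exact ⟨by simpa using congrArg Complex.re this, by simpa using congrArg Complex.im this⟩
  have hh : ∀ j < n - 1, torusHeight z j = torusHeight w j := by
    intro j hj
    have hk : kleinHeight z j = kleinHeight w j := by
      rcases Nat.even_or_odd' j with ⟨q, rfl | rfl⟩
      · exact (hq ⟨q, by omega⟩).1
      · exact (hq ⟨q, by omega⟩).2
    simpa [kleinHeight, show j + 1 < n by omega] using hk
  have hc := torusCoord_eq_of_height_eq (n - 1) hr hh
  funext i
  apply Subtype.ext
  have hi : torusCoord z i = torusCoord w i := by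
    rcases Nat.lt_or_ge i (n - 1) with h | h
    · exact hc i h
    · rw [show (i : ℕ) = n - 1 by omega, hl]
  simpa [torusCoord] using hi

theorem kleinMap_eq_iff (hn : 1 ≤ n) {z w : Torus n} :
    kleinMap z = kleinMap w ↔ w = z ∨ w = kleinInvolution n z := by
  constructor
  · intro h
    have h1 := congrArg Prod.fst h
    simp only [kleinMap] at h1
    have hr : torusRadius z (n - 1) = torusRadius w (n - 1) := by
      have := congrArg norm h1
      simpa [norm_torusCoord, abs_of_pos, torusRadius_pos] using this
    have hsq : torusCoord z (n - 1) ^ 2 = torusCoord w (n - 1) ^ 2 := by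
      rw [hr] at h1
      exact mul_left_cancel₀ (by exact_mod_cast (torusRadius_pos w _).ne') h1
    rcases sq_eq_sq_iff_eq_or_eq_neg.1 hsq with h' | h'
    · exact Or.inl (eq_of_kleinMap_eq hn h h').symm
    · refine Or.inr (eq_of_kleinMap_eq hn (h.symm.trans (kleinMap_kleinInvolution hn z).symm) ?_)
      rw [torusCoord_kleinInvolution_last z hn, h', neg_neg]
  · rintro (rfl | rfl)
    · rfl
    · exact (kleinMap_kleinInvolution hn z).symm

theorem Klein.mk_eq_mk_iff (hn : 1 ≤ n) {z w : Torus n} :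
    (Quot.mk (KleinRel n) z : Klein n) = Quot.mk (KleinRel n) w ↔
      w = z ∨ w = kleinInvolution n z := by
  constructor
  · intro h
    rw [← kleinMap_eq_iff hn]
    exact congrArg (Quot.lift kleinMap fun a b (hab : b = _) => by
      rw [hab, kleinMap_kleinInvolution hn]) h
  · rintro (rfl | rfl)
    · rfl
    · exact Quot.sound rfl

instance : CompactSpace (Klein n) := inferInstanceAs (CompactSpace (Quot (KleinRel n)))

theorem Klein.exists_isEmbedding (hn : 1 ≤ n) {d : ℕ} (hd : 2 + 2 * (n / 2) ≤ d) :
    ∃ f : Klein n → EuclideanSpace ℝ (Fin d), Topology.IsEmbedding f := by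
  obtain ⟨L, hL⟩ : ∃ L : (ℂ × (Fin (n / 2) → ℂ)) →ₗ[ℝ] EuclideanSpace ℝ (Fin d),
      Function.Injective L := by
    obtain ⟨v, hv⟩ := exists_linearIndependent_of_le_finrank (R := ℝ)
      (M := EuclideanSpace ℝ (Fin d)) (n := 2 + 2 * (n / 2)) (by simpa using hd)
    let b := Module.finBasisOfFinrankEq ℝ (ℂ × (Fin (n / 2) → ℂ)) (n := 2 + 2 * (n / 2)) (by
      rw [Module.finrank_prod, Module.finrank_pi_fintype]
      simp [Complex.finrank_real_complex, mul_comm])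
    exact ⟨b.constr ℝ v, b.injective_constr_of_linearIndependent hv⟩
  let g : Klein n → ℂ × (Fin (n / 2) → ℂ) := Quot.lift kleinMap fun a b (hab : b = _) => by
    rw [hab, kleinMap_kleinInvolution hn]
  have hg : Continuous g := continuous_quot_lift _ continuous_kleinMap
  have hinj : Function.Injective g := by
    rintro ⟨z⟩ ⟨w⟩ h
    exact (Klein.mk_eq_mk_iff hn).2 ((kleinMap_eq_iff hn).1 h)
  exact ⟨L ∘ g, (((LinearMap.continuous_of_finiteDimensional L).comp hg).isClosedEmbedding
    (hL.comp hinj)).isEmbedding⟩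

end Embedding

section SignLabel

variable {d : ℕ}

theorem exists_antipodal_label (d : ℕ) :
    ∃ τ : (Fin d → ℝ) → ZMod 2, ∀ v, v ≠ 0 → τ (-v) = τ v + 1 := by
  classical
  refine ⟨fun v => if WellOrderingRel v (-v) then 1 else 0, fun v hv => ?_⟩
  have hne : v ≠ -v := fun h => hv (self_eq_neg.1 h)
  simp only [neg_neg]
  rcases trichotomous_of WellOrderingRel v (-v) with h | h | h
  · rw [if_neg (asymm h), if_pos h]; rfl
  · exact absurd h hne
  · rw [if_pos h, if_neg (asymm h), zero_add]

/-- The sign of the `k`-th coordinate of a vector, with zeros and missing coordinates resolved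
so that opposite nonzero vectors receive opposite signs. -/
def signLabel (v : Fin d → ℝ) (k : ℕ) : ZMod 2 :=
  if h : k < d then
    if 0 < v ⟨k, h⟩ then 1 else if v ⟨k, h⟩ < 0 then 0 else (exists_antipodal_label d).choose v
  else (exists_antipodal_label d).choose v

theorem signLabel_neg {v : Fin d → ℝ} (hv : v ≠ 0) (k : ℕ) :
    signLabel (-v) k = signLabel v k + 1 := by
  have hτ := (exists_antipodal_label d).choose_spec v hv
  unfold signLabel
  by_cases h : k < d
  · simp only [h, dite_true, Pi.neg_apply]
    rcases lt_trichotomy (v ⟨k, h⟩) 0 with h0 | h0 | h0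
    · simp [h0, not_lt.2 h0.le]
    · simp [h0, hτ]
    · simp only [h0, if_true, Left.neg_pos_iff, not_lt.2 h0.le, if_false, Left.neg_neg_iff]
      rfl
  · simp only [h, dite_false, hτ]

theorem abs_le_of_signLabel_ne {v w : Fin d → ℝ} {k : Fin d}
    (h : signLabel w k ≠ signLabel v k) : |v k| ≤ |v k - w k| := by
  by_contra! hc
  apply h
  unfold signLabel
  simp only [k.2, dite_true, Fin.eta]
  rcases lt_trichotomy (v k) 0 with h0 | h0 | h0
  · have : w k < 0 := by
      by_contra! hw
      rw [abs_of_neg h0, abs_of_nonpos (by linarith)] at hc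
      linarith
    simp [h0, this, not_lt.2 h0.le, not_lt.2 this.le]
  · rw [h0, abs_zero] at hc
    exact absurd hc (not_lt.2 (abs_nonneg _))
  · have : 0 < w k := by
      by_contra! hw
      rw [abs_of_pos h0, abs_of_nonneg (by linarith)] at hc
      linarith
    simp [h0, this]

variable {ι : Type*} [DecidableEq ι] [Fintype ι]

theorem exists_forall_cupCount_eq_zero {Γ : (ι → ℝ) → (Fin d → ℝ)} (hΓ : Continuous Γ)
    {K : Finset ι} {r : ι} (hr : r ∉ K)
    (h0 : ∀ u : ι → ℝ, (∀ i, |u i| ≤ 1) → 0 ≤ u r → (∃ i ∈ K, u i ≠ 0) → Γ u ≠ 0) :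
    ∃ N : ℕ, 0 < N ∧ ∀ σ ⊆ K, ∀ i ∈ K, ∀ J : Finset ι, i ∉ J → J.card = d →
      cupCount N (orthantLabel (fun k v => signLabel (Γ fun j => (v j : ℝ) / N) k) σ) J
        (Pi.single i N) = 0 := by
  let B : Set (ι → ℝ) := Set.Icc (-1) 1
  have hB : IsCompact B := isCompact_Icc
  have hBmem : ∀ u : ι → ℝ, u ∈ B ↔ ∀ i, |u i| ≤ 1 := fun u => by
    simp only [B, Set.mem_Icc, Pi.le_def, abs_le, Pi.neg_apply, Pi.one_apply, forall_and]
  let C : Set (ι → ℝ) := B ∩ ({u | 0 ≤ u r} ∩ ⋃ i ∈ K, {u | |u i| = 1})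
  have hC : IsCompact C := by
    refine hB.inter_right (IsClosed.inter ?_ (isClosed_biUnion_finset fun i _ => ?_))
    · exact isClosed_le continuous_const (continuous_apply r)
    · exact isClosed_eq (continuous_apply i).abs continuous_const
  obtain ⟨δ, hδ, hCδ⟩ : ∃ δ : ℝ, 0 < δ ∧ ∀ u ∈ C, δ ≤ ‖Γ u‖ := by
    refine hC.exists_forall_le' hΓ.norm.continuousOn (a := 0) fun u hu => ?_
    obtain ⟨hu1, hu2, hu3⟩ := hu
    simp only [Set.mem_iUnion, Set.mem_ofPred_eq, exists_prop] at hu3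
    obtain ⟨i, hi, hui⟩ := hu3
    exact norm_pos_iff.2 (h0 u ((hBmem u).1 hu1) hu2
      ⟨i, hi, fun h => by rw [h, abs_zero] at hui; exact zero_ne_one hui⟩)
  obtain ⟨η, hη, hBη⟩ := Metric.uniformContinuousOn_iff.1
    (hB.uniformContinuousOn_of_continuous hΓ.continuousOn) δ hδ
  obtain ⟨m, hm⟩ := exists_nat_one_div_lt hη
  refine ⟨m + 1, m.succ_pos, fun σ hσ i hi J hiJ hJ => ?_⟩
  have hN : (0 : ℝ) < ((m + 1 : ℕ) : ℝ) := by positivity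
  refine Finset.sum_eq_zero fun x hx => ?_
  by_contra hne
  let pt : (ι → ℕ) → ι → ℝ := fun y j =>
    (negOn σ (fun i => (y i : ℤ)) j : ℝ) / ((m + 1 : ℕ) : ℝ)
  have hptB : ∀ y ∈ Set.Icc x (cubeTop J x), pt y ∈ B := by
    intro y hy
    rw [hBmem]
    intro j
    have hyj : y j ≤ m + 1 := by
      obtain ⟨h1, h2⟩ := Icc_cubeTop_of_mem_gridBox hx hy
      by_cases hj : j ∈ J
      · exact h1 j hj
      · rw [h2 j hj]
        by_cases hji : j = i
        · subst hji; simp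
        · simp [hji]
    have habs := abs_negOn σ (fun i => (y i : ℤ)) j
    simp only [pt, abs_div, abs_of_pos hN]
    rw [div_le_one hN, ← Int.cast_abs, habs]
    simpa using (by exact_mod_cast hyj : ((y j : ℕ) : ℝ) ≤ ((m + 1 : ℕ) : ℝ))
  have hxx : x ∈ Set.Icc x (cubeTop J x) := ⟨le_rfl, le_cubeTop J x⟩
  have hxC : pt x ∈ C := by
    refine ⟨hptB x hxx, ?_, ?_⟩
    · have : r ∉ σ := fun h => hr (hσ h)
      simp only [Set.mem_ofPred_eq, pt, negOn, this, if_false]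
      positivity
    · simp only [Set.mem_iUnion, Set.mem_ofPred_eq, exists_prop]
      refine ⟨i, hi, ?_⟩
      have hxi : x i = m + 1 := by
        rw [(mem_gridBox.1 hx).2 i hiJ, Pi.single_eq_same]
      have habs := abs_negOn σ (fun i => (x i : ℤ)) i
      simp only [pt, abs_div, abs_of_pos hN]
      rw [div_eq_one_iff_eq hN.ne', ← Int.cast_abs, habs, hxi]
      push_cast
      exact abs_of_pos (by positivity)
  refine absurd (hCδ _ hxC) (not_le.2 ?_)
  rw [pi_norm_lt_iff hδ]
  intro k
  obtain ⟨y, hy, hyk⟩ : ∃ y ∈ Set.Icc x (cubeTop J x),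
      signLabel (Γ (pt y)) k ≠ signLabel (Γ (pt x)) k := by
    by_contra! hc
    exact hne (cupPower_eq_zero _ _ _ _ k (by rw [hJ]; exact k.2) hc)
  have hdist : dist (pt x) (pt y) < η := by
    refine lt_of_le_of_lt ((dist_pi_le_iff (by positivity)).2 fun j => ?_) hm
    have h1 : x j ≤ y j := hy.1 j
    have h2 : y j ≤ x j + 1 := (hy.2 j).trans (by simp only [cubeTop]; split_ifs <;> omega)
    have h1' : (x j : ℝ) ≤ y j := by exact_mod_cast h1
    have h2' : (y j : ℝ) ≤ x j + 1 := by exact_mod_cast h2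
    rw [Real.dist_eq, ← sub_div, abs_div, abs_of_pos hN]
    push_cast
    refine div_le_div_of_nonneg_right ?_ (by positivity)
    simp only [negOn]
    split_ifs <;> push_cast <;> rw [abs_le] <;> constructor <;> linarith
  calc ‖Γ (pt x) k‖ ≤ |Γ (pt x) k - Γ (pt y) k| := abs_le_of_signLabel_ne hyk
    _ ≤ dist (Γ (pt x)) (Γ (pt y)) := dist_le_pi_dist (Γ (pt x)) (Γ (pt y)) k
    _ < δ := hBη _ (hptB x hxx) _ (hptB y hy) hdist

end SignLabel

section NonEmbedding

open Real

theorem Circle.conj_exp (t : ℝ) : (Circle.exp t).conj = Circle.exp (-t) := by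
  apply Subtype.ext
  simp only [Circle.conj, Circle.coe_exp, ← Complex.exp_conj]
  simp

theorem Circle.neg_exp (t : ℝ) : (Circle.exp t).neg = Circle.exp (t + π) := by
  apply Subtype.ext
  simp [Circle.neg, Circle.coe_exp]

variable {n : ℕ}

/-- A family of points of the torus. The parameter `Sum.inr false` rotates the last factor. -/
def torusPoint (c : ℝ) (u : Fin n ⊕ Bool → ℝ) : Torus n := fun i =>
  if (i : ℕ) + 1 = n then Circle.exp (π * u (.inr false) + c * u (.inl i) * (π / 2))
  else Circle.exp (π * (c * u (.inl i)))

theorem continuous_torusPoint {X : Type*} [TopologicalSpace X] {c : X → ℝ}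
    {u : X → Fin n ⊕ Bool → ℝ} (hc : Continuous c) (hu : Continuous u) :
    Continuous fun x => torusPoint (c x) (u x) := by
  refine continuous_pi fun i => ?_
  unfold torusPoint
  split_ifs
  · exact Circle.exp.continuous.comp (by fun_prop)
  · exact Circle.exp.continuous.comp (by fun_prop)

theorem torusPoint_glue {c : ℝ} {u u' : Fin n ⊕ Bool → ℝ} (hφ : u (.inr false) = 1)
    (hφ' : u' (.inr false) = 0)
    (hl : ∀ i : Fin n, (i : ℕ) + 1 = n → u' (.inl i) = u (.inl i))
    (hK : ∀ i : Fin n, (i : ℕ) + 1 ≠ n → u' (.inl i) = -u (.inl i)) :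
    torusPoint c u = kleinInvolution n (torusPoint c u') := by
  funext i
  by_cases hi : (i : ℕ) + 1 = n
  · simp only [torusPoint, kleinInvolution, hi, if_true, Circle.neg_exp, hφ, hφ', hl i hi]
    congr 1; ring
  · simp only [torusPoint, kleinInvolution, hi, if_false, Circle.conj_exp, hK i hi]
    congr 1; ring

theorem torusPoint_zero_congr {u u' : Fin n ⊕ Bool → ℝ}
    (hφ : u' (.inr false) = u (.inr false)) : torusPoint 0 u' = torusPoint 0 u := by
  funext i
  simp [torusPoint, hφ]

theorem Circle.exp_pi_mul_neg {t : ℝ} (ht : |t| = 1) :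
    Circle.exp (π * -t) = Circle.exp (π * t) := by
  rw [Circle.exp_eq_exp]
  rcases (abs_eq zero_le_one).1 ht with rfl | rfl
  · exact ⟨-1, by push_cast; ring⟩
  · exact ⟨1, by push_cast; ring⟩

theorem torusPoint_one_fold {u u' : Fin n ⊕ Bool → ℝ} {j : Fin n} (hj : (j : ℕ) + 1 ≠ n)
    (hu : |u (.inl j)| = 1) (hu' : u' (.inl j) = -u (.inl j))
    (h : ∀ i, i ≠ .inl j → u' i = u i) : torusPoint 1 u' = torusPoint 1 u := by
  funext i
  by_cases hij : i = j
  · subst hij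
    simp only [torusPoint, hj, if_false, hu', one_mul, Circle.exp_pi_mul_neg hu]
  · simp only [torusPoint, h (.inl i) (by simpa using hij), h (.inr false) (by simp)]

theorem torusPoint_one_fold_last {u u' : Fin n ⊕ Bool → ℝ} {l : Fin n} (hl : (l : ℕ) + 1 = n)
    (hu : |u (.inl l)| = 1) (hu' : ∀ i : Fin n, u' (.inl i) = -u (.inl i))
    (hφ : u' (.inr false) = u (.inr false)) :
    torusPoint 1 u' = kleinInvolution n (torusPoint 1 u) := by
  funext i
  by_cases hi : (i : ℕ) + 1 = n
  · obtain rfl : i = l := Fin.ext (by omega)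
    simp only [torusPoint, kleinInvolution, hi, if_true, Circle.neg_exp, hu', hφ]
    rw [Circle.exp_eq_exp]
    rcases (abs_eq zero_le_one).1 hu with h | h <;> rw [h]
    · exact ⟨-1, by push_cast; ring⟩
    · exact ⟨0, by push_cast; ring⟩
  · simp only [torusPoint, kleinInvolution, hi, if_false, Circle.conj_exp, hu']
    congr 1; ring

theorem torusPoint_neg {c : ℝ} {u u' : Fin n ⊕ Bool → ℝ}
    (hu' : ∀ i : Fin n, u' (.inl i) = -u (.inl i)) (hφ : u' (.inr false) = u (.inr false)) :
    torusPoint c u' = torusPoint (-c) u := by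
  funext i
  simp only [torusPoint, hu', hφ, mul_neg, neg_mul]

theorem Circle.eq_zero_of_exp_eq {s t : ℝ} (h : Circle.exp s = Circle.exp t)
    (hst : |s - t| < 2 * π) : s = t := by
  obtain ⟨m, hm⟩ := Circle.exp_eq_exp.1 h
  have hm' : s - t = m * (2 * π) := by linarith
  rw [hm', abs_mul, abs_of_pos Real.two_pi_pos] at hst
  have h1 : |(m : ℝ)| < 1 := by nlinarith [Real.two_pi_pos]
  have h2 : m = 0 := Int.abs_lt_one_iff.1 (by exact_mod_cast h1)
  rw [h2] at hm'
  simp at hm'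
  linarith

theorem torusPoint_injective {a b : ℝ} (h0 : a ≠ b) (h1 : |a - b| ≤ 1)
    {u : Fin n ⊕ Bool → ℝ} (hu : ∀ i, |u i| ≤ 1) (h : torusPoint a u = torusPoint b u)
    (i : Fin n) : u (.inl i) = 0 := by
  have hi := congrFun h i
  have hab : |(a - b) * u (.inl i)| ≤ 1 := by
    rw [abs_mul]; exact mul_le_one₀ h1 (abs_nonneg _) (hu _)
  have hπ := Real.pi_pos
  suffices hz : (a - b) * u (.inl i) = 0 from
    (mul_eq_zero.1 hz).resolve_left (sub_ne_zero.2 h0)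
  by_cases hin : (i : ℕ) + 1 = n
  · simp only [torusPoint, hin, if_true] at hi
    have := Circle.eq_zero_of_exp_eq hi (by
      rw [show π * u (.inr false) + a * u (.inl i) * (π / 2) -
        (π * u (.inr false) + b * u (.inl i) * (π / 2)) = (a - b) * u (.inl i) * (π / 2) by ring,
        abs_mul, abs_of_pos (by positivity : 0 < π / 2)]
      nlinarith)
    have : (a - b) * u (.inl i) * (π / 2) = 0 := by linarith
    exact (mul_eq_zero.1 this).resolve_right (by positivity)
  · simp only [torusPoint, hin, if_false] at hi
    have := Circle.eq_zero_of_exp_eq hi (by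
      rw [show π * (a * u (.inl i)) - π * (b * u (.inl i)) = (a - b) * u (.inl i) * π by ring,
        abs_mul, abs_of_pos hπ]
      nlinarith)
    have : (a - b) * u (.inl i) * π = 0 := by linarith
    exact (mul_eq_zero.1 this).resolve_right hπ.ne'

theorem torusPoint_ne_kleinInvolution (hn : 1 ≤ n) {a b : ℝ} (h1 : |a - b| ≤ 1)
    {u : Fin n ⊕ Bool → ℝ} (hu : ∀ i, |u i| ≤ 1) :
    torusPoint a u ≠ kleinInvolution n (torusPoint b u) := by
  intro h
  let l : Fin n := ⟨n - 1, by omega⟩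
  have hl : (l : ℕ) + 1 = n := by simp [l]; omega
  have hi := congrFun h l
  have hab : |(a - b) * u (.inl l)| ≤ 1 := by
    rw [abs_mul]; exact mul_le_one₀ h1 (abs_nonneg _) (hu _)
  obtain ⟨hab1, hab2⟩ := abs_le.1 hab
  have hπ := Real.pi_pos
  simp only [torusPoint, kleinInvolution, hl, if_true, Circle.neg_exp] at hi
  have h2 : (a - b) * u (.inl l) * (π / 2) - π = 0 := by
    have := Circle.eq_zero_of_exp_eq hi (by rw [abs_lt]; constructor <;> nlinarith)
    linarith
  nlinarith

variable {d : ℕ}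

/-- The difference of the values of a map at two points of the Klein bottle. -/
def kleinDiff (f : Klein n → Fin d → ℝ) (u : Fin n ⊕ Bool → ℝ) : Fin d → ℝ :=
  f (Quot.mk _ (torusPoint (-((1 - u (.inr true)) / 4)) u)) -
    f (Quot.mk _ (torusPoint (1 / 4 + 3 * u (.inr true) / 4) u))

theorem continuous_kleinDiff {f : Klein n → Fin d → ℝ} (hf : Continuous f) :
    Continuous (kleinDiff f) := by
  have hq : Continuous (Quot.mk (KleinRel n) : Torus n → Klein n) := continuous_quot_mk
  refine Continuous.sub (hf.comp (hq.comp ?_)) (hf.comp (hq.comp ?_))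
  · exact continuous_torusPoint (by fun_prop) continuous_id
  · exact continuous_torusPoint (by fun_prop) continuous_id

theorem kleinDiff_ne_zero (hn : 1 ≤ n) {f : Klein n → Fin d → ℝ} (hf : Function.Injective f)
    {u : Fin n ⊕ Bool → ℝ} (hu : ∀ i, |u i| ≤ 1) (hr : 0 ≤ u (.inr true))
    (hK : ∃ i : Fin n, u (.inl i) ≠ 0) : kleinDiff f u ≠ 0 := by
  intro h
  obtain ⟨i, hi⟩ := hK
  have hr1 := (abs_le.1 (hu (.inr true))).2
  rcases (Klein.mk_eq_mk_iff hn).1 (hf (sub_eq_zero.1 h)) with h' | h'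
  · exact hi (torusPoint_injective (by linarith) (by rw [abs_le]; constructor <;> linarith)
      hu h' i)
  · exact torusPoint_ne_kleinInvolution hn (by rw [abs_le]; constructor <;> linarith) hu h'

theorem pairLabelling_kleinDiff (hn : 1 ≤ n) {f : Klein n → Fin d → ℝ}
    (hf : Function.Injective f) {N : ℕ} (hN : 0 < N) :
    PairLabelling N (Finset.univ.map Function.Embedding.inl : Finset (Fin n ⊕ Bool))
      (.inl ⟨n - 1, by omega⟩) (.inr false) (.inr true)
      (fun k v => signLabel (kleinDiff f fun j => (v j : ℝ) / N) k) := by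
  have hN' : (0 : ℝ) < N := by exact_mod_cast hN
  have hmk : ∀ z : Torus n, (Quot.mk (KleinRel n) (kleinInvolution n z) : Klein n) =
      Quot.mk (KleinRel n) z := fun z =>
    ((Klein.mk_eq_mk_iff hn).2 (.inr rfl)).symm
  have habs : ∀ m : ℤ, |m| = N → |(m : ℝ) / N| = 1 := fun m hm => by
    rw [abs_div, abs_of_pos hN', div_eq_one_iff_eq hN'.ne', ← Int.cast_abs, hm]; simp
  refine ⟨by simp, by simp, by simp, by simp, ?_, ?_, ?_, ?_⟩
  · rintro k v hv hr ⟨i, hi, hvi⟩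
    obtain ⟨i, rfl⟩ : ∃ j, Sum.inl j = i := by simpa using hi
    rw [← signLabel_neg]
    · congr 1
      unfold kleinDiff
      rw [neg_sub]
      have h1 : ∀ c : ℝ, torusPoint c (fun j => (negOn (Finset.univ.map Function.Embedding.inl) v j
          : ℝ) / N) = torusPoint (-c) (fun j => (v j : ℝ) / N) := fun c =>
        torusPoint_neg (fun i => by simp [negOn, neg_div]) (by simp [negOn])
      rw [h1, h1]
      simp [negOn, hr]
    · refine kleinDiff_ne_zero hn hf (fun j => ?_) (by simp [hr]) ⟨i, ?_⟩
      · rw [abs_div, abs_of_pos hN', div_le_one hN', ← Int.cast_abs]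
        exact_mod_cast hv j
      · exact div_ne_zero (by exact_mod_cast hvi) hN'.ne'
  · intro k v hv
    congr 1
    have h1 : ∀ c : ℝ, torusPoint c (fun j => (v j : ℝ) / N) = kleinInvolution n (torusPoint c
        fun j => (negOn ((Finset.univ.map Function.Embedding.inl).erase (.inl ⟨n - 1, by omega⟩))
          (Function.update v (.inr false) 0) j : ℝ) / N) := fun c => by
      refine torusPoint_glue (by simp [hv, hN'.ne']) (by simp [negOn]) (fun i hi => ?_)
        (fun i hi => ?_)
      · simp [negOn, show i = ⟨n - 1, by omega⟩ from Fin.ext (by simp; omega)]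
      · simp [negOn, neg_div, show i ≠ ⟨n - 1, by omega⟩ from fun e => hi (by rw [e]; simp; omega)]
    unfold kleinDiff
    simp only [h1, hmk]
    simp [negOn]
  · intro k v hv i hi hvi
    obtain ⟨hil, j, rfl⟩ : i ≠ .inl ⟨n - 1, by omega⟩ ∧ ∃ j, Sum.inl j = i := by simpa using hi
    congr 1
    have hj : (j : ℕ) + 1 ≠ n := fun e => hil (congrArg _ (Fin.ext (by simp; omega)))
    have h1 := torusPoint_one_fold (u := fun a => (v a : ℝ) / N)
      (u' := fun a => (negOn {Sum.inl j} v a : ℝ) / N) hj (habs _ hvi)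
      (by simp [negOn, neg_div]) (fun a ha => by simp [negOn, ha])
    have h0 := torusPoint_zero_congr (n := n) (u := fun a => (v a : ℝ) / N)
      (u' := fun a => (negOn {Sum.inl j} v a : ℝ) / N) (by simp [negOn])
    have hr : (v (.inr true) : ℝ) / N = 1 := by simp [hv, hN'.ne']
    have hr' : (negOn {Sum.inl j} v (.inr true) : ℝ) / N = 1 := by simpa [negOn] using hr
    unfold kleinDiff
    simp only [hr, hr']
    norm_num [h0, h1]
  · intro k v hv hvl
    congr 1
    have h1 := torusPoint_one_fold_last (u := fun a => (v a : ℝ) / N)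
      (u' := fun a => (negOn (Finset.univ.map Function.Embedding.inl) v a : ℝ) / N)
      (l := ⟨n - 1, by omega⟩) (by simp; omega) (habs _ hvl)
      (fun i => by simp [negOn, neg_div]) (by simp [negOn])
    have h0 := torusPoint_zero_congr (n := n) (u := fun a => (v a : ℝ) / N)
      (u' := fun a => (negOn (Finset.univ.map Function.Embedding.inl) v a : ℝ) / N)
      (by simp [negOn])
    have hr : (v (.inr true) : ℝ) / N = 1 := by simp [hv, hN'.ne']
    have hr' : (negOn (Finset.univ.map Function.Embedding.inl) v (.inr true) : ℝ) / N = 1 := by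
      simpa [negOn] using hr
    unfold kleinDiff
    simp only [hr, hr']
    norm_num [h0, h1, hmk]

theorem Klein.not_continuous_injective (hn : 1 ≤ n) (hd : d = n ∨ d = n + 1 ∧ Even n)
    {f : Klein n → EuclideanSpace ℝ (Fin d)} (hc : Continuous f) : ¬ Function.Injective f := by
  intro hf
  let g : Klein n → Fin d → ℝ := fun x => WithLp.ofLp (f x)
  have hg : Continuous g := (PiLp.continuous_ofLp 2 _).comp hc
  have hgi : Function.Injective g := (WithLp.ofLp_injective 2).comp hf
  obtain ⟨N, hN, hzero⟩ := exists_forall_cupCount_eq_zero (continuous_kleinDiff hg)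
    (K := Finset.univ.map Function.Embedding.inl) (r := .inr true) (by simp)
    (fun u hu hr hK => kleinDiff_ne_zero hn hgi hu hr (by simpa using hK))
  have H := pairLabelling_kleinDiff hn hgi hN
  rcases hd with rfl | ⟨rfl, hev⟩
  · obtain ⟨σ, hσ, i, hi, hne⟩ := H.exists_cupCount_ne_zero hN
    obtain ⟨i, rfl⟩ : ∃ j, Sum.inl j = i := by simpa using hi
    refine hne (hzero σ hσ _ hi _ (by simp) ?_)
    rw [Finset.card_union_of_disjoint (by simp), Finset.card_erase_of_mem hi]
    simp
    omega
  · obtain ⟨σ, hσ, i, hi, hne⟩ := H.exists_cupCount_ne_zero_of_even hN (by simpa using hev)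
    obtain ⟨i, rfl⟩ : ∃ j, Sum.inl j = i := by simpa using hi
    refine hne (hzero σ hσ _ hi _ (by simp) ?_)
    rw [Finset.card_union_of_disjoint (by simp), Finset.card_erase_of_mem hi]
    simp
    omega

end NonEmbedding

/-- The smallest Euclidean space in which `Kₙ` embeds is `ℝ^{n+1}` for
`n` odd and `ℝ^{n+2}` for `n` even: `Kₙ` always embeds in `ℝ^{n+2}`; for odd `n` it embeds
in `ℝ^{n+1}` but not in `ℝⁿ`; and for even `n` it does not embed in `ℝ^{n+1}`. -/
theorem klein_embedding_dimension (n : ℕ) (hn : 1 ≤ n) :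
    (∃ f : Klein n → EuclideanSpace ℝ (Fin (n + 2)), Topology.IsEmbedding f) ∧
    (Odd n →
      (∃ f : Klein n → EuclideanSpace ℝ (Fin (n + 1)), Topology.IsEmbedding f) ∧
      ¬ ∃ f : Klein n → EuclideanSpace ℝ (Fin n), Topology.IsEmbedding f) ∧
    (Even n →
      ¬ ∃ f : Klein n → EuclideanSpace ℝ (Fin (n + 1)), Topology.IsEmbedding f) := by
  refine ⟨Klein.exists_isEmbedding hn (by omega), fun hodd =>
    ⟨Klein.exists_isEmbedding hn (by obtain ⟨k, rfl⟩ := hodd; omega), ?_⟩, ?_⟩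
  · rintro ⟨f, hf⟩
    exact Klein.not_continuous_injective hn (.inl rfl) hf.continuous hf.injective
  · rintro hev ⟨f, hf⟩
    exact Klein.not_continuous_injective hn (.inr ⟨rfl, hev⟩) hf.continuous hf.injective
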